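/- Let m ≥ 2, let A, j*, d and the sets P_0, P_1, P_d be as in the context, suppose a_{l,j*} > 0 for some l ∈ {1,…,n}, let B be a positive definite m×m matrix, and suppose C ∈ ℝ^{mn} with C ∉ P_1. Define, for v_1, v_2 ∈ ℝ^m: B_1 = (B^{-1} + v_1v_1ᵀ)^{-1}, B_2 = (B^{-1} + v_1v_1ᵀ + v_2v_2ᵀ)^{-1}, Q_1(v_1) = diag{I_m,…,I_m, B_1B^{-1}, I_m,…,I_m} (the block B_1B^{-1} in position j*), Q_2(v_1,v_2) = diag{I_m,…,I_m, B_2B_1^{-1}, I_m,…,I_m} (the block in position j*), and Q_3(v_1,v_2) = (A⊗I_m)Q_2(v_1,v_2)(A⊗I_m)Q_1(v_1)C. Then for every L > 0 there exist v_1, v_2 ∈ ℝ^m such that (A⊗I_m)Q_1(v_1)C ∉ P_0, Q_3(v_1,v_2) ∉ P_d, and |Q_3(v_1,v_2)[m(l−1)+1]| > L. -/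

import Mathlib

open BigOperators Matrix
open Filter Topology

/-- A Sherman–Morrison formula: the action of `(M + q qᵀ)⁻¹ M`, with `h = M⁻¹ q`. -/
lemma inv_add_vecMulVec_mul_mulVec {m : ℕ} {M : Matrix (Fin m) (Fin m) ℝ} {q h : Fin m → ℝ}
    (hM : (M + vecMulVec q q).PosDef) (hh : M *ᵥ h = q) (hq : 1 + q ⬝ᵥ h ≠ 0) (w : Fin m → ℝ) :
    ((M + vecMulVec q q)⁻¹ * M) *ᵥ w = w - ((q ⬝ᵥ w) / (1 + q ⬝ᵥ h)) • h := by
  have hdet : IsUnit (M + vecMulVec q q).det := hM.det_pos.ne'.isUnit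
  have key : (M + vecMulVec q q) *ᵥ (w - ((q ⬝ᵥ w) / (1 + q ⬝ᵥ h)) • h) = M *ᵥ w := by
    ext i
    simp only [add_mulVec, mulVec_sub, mulVec_smul, hh, vecMulVec_mulVec, Pi.add_apply,
      Pi.sub_apply, Pi.smul_apply, smul_eq_mul, MulOpposite.smul_eq_mul_unop,
      MulOpposite.unop_op]
    field_simp
    ring
  rw [← mulVec_mulVec, ← key, mulVec_mulVec, nonsing_inv_mul _ hdet, one_mulVec]

lemma Matrix.PosDef.add_vecMulVec_self {m : ℕ} {M : Matrix (Fin m) (Fin m) ℝ}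
    (hM : M.PosDef) (q : Fin m → ℝ) : (M + vecMulVec q q).PosDef := by
  simpa using hM.add_posSemidef (posSemidef_vecMulVec_self_star q)

lemma Filter.Tendsto.abs_add_const_mul_atTop {α : Type*} {l : Filter α} {f z : α → ℝ} {c β : ℝ}
    (hf : Tendsto f l (𝓝 c)) (hz : Tendsto (fun t => |z t|) l atTop) (hβ : β ≠ 0) :
    Tendsto (fun t => |f t + β * z t|) l atTop := by
  have h : Tendsto (fun t => -|f t| + |β| * |z t|) l atTop :=
    hf.abs.neg.add_atTop (hz.const_mul_atTop (abs_pos.mpr hβ))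
  refine tendsto_atTop_mono (fun t => ?_) h
  have := abs_sub_abs_le_abs_sub (β * z t) (-f t)
  rw [abs_mul, abs_neg, sub_neg_eq_add, add_comm (β * z t)] at this
  linarith

/-- For the direction `p = e₀ + ε e₁` with `ε` small, the limiting state stays off the hyperplane
`{w | w₀ = 0}`. -/
lemma exists_direction {m : ℕ} {B : Matrix (Fin m) (Fin m) ℝ} (hB : B.PosDef) (x u : Fin m → ℝ)
    (a : ℝ) {i₀ i₁ : Fin m} (hi : i₀ ≠ i₁) (hu : u i₀ ≠ 0) :
    ∃ p g : Fin m → ℝ, p ⬝ᵥ g = 0 ∧ g i₀ ≠ 0 ∧ p ≠ 0 ∧ p ⬝ᵥ u ≠ 0 ∧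
      u i₀ + a * (x i₀ - (p ⬝ᵥ x) / (p ⬝ᵥ B *ᵥ p) * (B *ᵥ p) i₀) ≠ 0 := by
  let p : ℝ → Fin m → ℝ := fun ε => Pi.single i₀ 1 + ε • Pi.single i₁ 1
  have hp : Continuous p := by fun_prop
  have hp0 : p 0 = Pi.single i₀ 1 := by simp [p]
  have hBp : Continuous fun ε => B *ᵥ p ε := Continuous.matrix_mulVec continuous_const hp
  have hd (f : ℝ → Fin m → ℝ) (hf : Continuous f) : Continuous fun ε => p ε ⬝ᵥ f ε :=
    Continuous.dotProduct hp hf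
  have hB0 : B i₀ i₀ ≠ 0 := hB.diag_pos.ne'
  have h1 : ∀ᶠ ε in 𝓝 (0 : ℝ), p ε ⬝ᵥ u ≠ 0 :=
    (hd _ continuous_const).continuousAt.eventually_ne (by simpa [hp0] using hu)
  have h2 : ∀ᶠ ε in 𝓝 (0 : ℝ),
      u i₀ + a * (x i₀ - (p ε ⬝ᵥ x) / (p ε ⬝ᵥ B *ᵥ p ε) * (B *ᵥ p ε) i₀) ≠ 0 := by
    refine ContinuousAt.eventually_ne ?_ ?_
    · refine continuousAt_const.add (continuousAt_const.mul (continuousAt_const.sub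
        (ContinuousAt.mul (ContinuousAt.div (hd _ continuous_const).continuousAt
          (hd _ hBp).continuousAt ?_) ?_)))
      · simpa [hp0] using hB0
      · exact ((continuous_apply i₀).comp hBp).continuousAt
    · simpa [hp0, hB0] using hu
  obtain ⟨ε, ⟨h1, h2⟩, hε⟩ := (((h1.and h2).filter_mono nhdsWithin_le_nhds).and
    (self_mem_nhdsWithin : ∀ᶠ ε in 𝓝[≠] (0 : ℝ), ε ≠ 0)).exists
  refine ⟨p ε, ε • Pi.single i₀ 1 - Pi.single i₁ 1, ?_, ?_, ?_, h1, h2⟩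
  · simp [p, hi, hi.symm]
  · simpa [hi] using hε
  · intro h
    simp [h] at h1

/-- Two consecutive rank-one updates can push the `i₀`-th coordinate of the state to infinity,
while the state after the first one converges and stays off the hyperplane `{w | w i₀ = 0}`. -/
lemma exists_rank_one_updates_tendsto_atTop {m : ℕ} {B : Matrix (Fin m) (Fin m) ℝ} (hB : B.PosDef)
    (x u : Fin m → ℝ) (a : ℝ) {i₀ i₁ : Fin m} (hi : i₀ ≠ i₁) (hu : u i₀ ≠ 0) :
    ∃ (v₁ v₂ : ℝ → Fin m → ℝ) (y₀ : ℝ), u i₀ + a * y₀ ≠ 0 ∧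
      Tendsto (fun t => (((B⁻¹ + vecMulVec (v₁ t) (v₁ t))⁻¹ * B⁻¹) *ᵥ x) i₀) atTop (𝓝 y₀) ∧
      Tendsto (fun t => |(((B⁻¹ + vecMulVec (v₁ t) (v₁ t) + vecMulVec (v₂ t) (v₂ t))⁻¹ *
        (B⁻¹ + vecMulVec (v₁ t) (v₁ t))) *ᵥ
          (u + a • (((B⁻¹ + vecMulVec (v₁ t) (v₁ t))⁻¹ * B⁻¹) *ᵥ x))) i₀|) atTop atTop := by
  obtain ⟨p, g, hpg, hg, hp, hpu, hne⟩ := exists_direction hB x u a hi hu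
  have hdet : IsUnit B.det := hB.det_pos.ne'.isUnit
  set s := p ⬝ᵥ B *ᵥ p with hs
  have hs0 : 0 < s := by simpa using hB.dotProduct_mulVec_pos hp
  set r := g ⬝ᵥ B⁻¹ *ᵥ g with hr
  have hr0 : 0 < r := by
    have hg0 : g ≠ 0 := fun h => hg (by simp [h])
    simpa using hB.inv.dotProduct_mulVec_pos hg0
  have hBB (v : Fin m → ℝ) : B⁻¹ *ᵥ B *ᵥ v = v := by
    rw [mulVec_mulVec, nonsing_inv_mul _ hdet, one_mulVec]
  have hsym (v : Fin m → ℝ) : (B⁻¹ *ᵥ g) ⬝ᵥ v = g ⬝ᵥ B⁻¹ *ᵥ v := by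
    have hT : (B⁻¹)ᵀ = B⁻¹ := by simpa using hB.inv.isHermitian.eq
    rw [dotProduct_mulVec, ← mulVec_transpose, hT]
  have hts (t : ℝ) : 0 < 1 + t ^ 2 * s := by positivity
  let κ : ℝ → ℝ := fun t => t ^ 2 / (1 + t ^ 2 * s)
  have hκ : Tendsto κ atTop (𝓝 (1 / s)) := by
    have h0 : Tendsto (fun t : ℝ => (t ^ 2)⁻¹) atTop (𝓝 0) :=
      tendsto_inv_atTop_zero.comp (tendsto_pow_atTop two_ne_zero)
    have h1 : Tendsto (fun t : ℝ => 1 / ((t ^ 2)⁻¹ + s)) atTop (𝓝 (1 / (0 + s))) :=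
      tendsto_const_nhds.div (h0.add_const s) (by simpa using hs0.ne')
    rw [zero_add] at h1
    refine h1.congr' ?_
    filter_upwards [eventually_gt_atTop 0] with t ht
    have := (hts t).ne'
    simp only [κ]
    field_simp
  let y : ℝ → Fin m → ℝ := fun t => x - (κ t * (p ⬝ᵥ x)) • (B *ᵥ p)
  have hy (t : ℝ) : ((B⁻¹ + vecMulVec (t • p) (t • p))⁻¹ * B⁻¹) *ᵥ x = y t := by
    have e : 1 + (t • p) ⬝ᵥ (t • B *ᵥ p) = 1 + t ^ 2 * s := by
      simp only [smul_dotProduct, dotProduct_smul, smul_eq_mul, ← hs]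
      ring
    rw [inv_add_vecMulVec_mul_mulVec (h := t • B *ᵥ p) (hB.inv.add_vecMulVec_self _)
      (by rw [mulVec_smul, hBB]) (by rw [e]; exact (hts t).ne'), e, smul_smul]
    simp only [y, κ, smul_dotProduct, smul_eq_mul]
    congr 2
    ring
  let q : ℝ → Fin m → ℝ := fun t => B⁻¹ *ᵥ g + t • p
  let h : ℝ → Fin m → ℝ := fun t => g + (t / (1 + t ^ 2 * s)) • (B *ᵥ p)
  have hh (t : ℝ) : (B⁻¹ + vecMulVec (t • p) (t • p)) *ᵥ h t = q t := by
    ext i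
    have := (hts t).ne'
    simp only [h, q, add_mulVec, mulVec_add, mulVec_smul, hBB, vecMulVec_mulVec, Pi.add_apply,
      Pi.smul_apply, smul_eq_mul, MulOpposite.smul_eq_mul_unop, MulOpposite.unop_op,
      smul_dotProduct, hpg, ← hs]
    field_simp
    ring
  have hqh (t : ℝ) : 1 + q t ⬝ᵥ h t = 1 + r + κ t * s := by
    have hgp : g ⬝ᵥ p = 0 := by rw [dotProduct_comm, hpg]
    simp only [h, q, κ, add_dotProduct, dotProduct_add, smul_dotProduct, dotProduct_smul,
      hsym, hBB, hpg, hgp, smul_eq_mul, ← hs, ← hr]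
    ring
  have hκ0 (t : ℝ) : 0 ≤ κ t := div_nonneg (sq_nonneg t) (hts t).le
  have hqh0 (t : ℝ) : 0 < 1 + r + κ t * s := by
    have := mul_nonneg (hκ0 t) hs0.le
    linarith
  let w : ℝ → Fin m → ℝ := fun t => u + a • y t
  have hz (t : ℝ) : ((B⁻¹ + vecMulVec (t • p) (t • p) + vecMulVec (q t) (q t))⁻¹ *
      (B⁻¹ + vecMulVec (t • p) (t • p))) *ᵥ w t =
        w t - ((q t ⬝ᵥ w t) / (1 + r + κ t * s)) • h t := by
    rw [inv_add_vecMulVec_mul_mulVec ((hB.inv.add_vecMulVec_self _).add_vecMulVec_self _) (hh t)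
      (by rw [hqh]; exact (hqh0 t).ne'), hqh]
  have hylim : Tendsto y atTop (𝓝 (x - (1 / s * (p ⬝ᵥ x)) • (B *ᵥ p))) :=
    tendsto_const_nhds.sub ((hκ.mul_const _).smul_const _)
  have hwlim : Tendsto w atTop (𝓝 (u + a • (x - (1 / s * (p ⬝ᵥ x)) • (B *ᵥ p)))) :=
    tendsto_const_nhds.add (hylim.const_smul a)
  have hinv : Tendsto (fun t : ℝ => t⁻¹) atTop (𝓝 0) := tendsto_inv_atTop_zero
  have hhlim : Tendsto (fun t => h t i₀) atTop (𝓝 (g i₀)) := by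
    have h1 : Tendsto (fun t => g i₀ + t⁻¹ * κ t * (B *ᵥ p) i₀) atTop
        (𝓝 (g i₀ + 0 * (1 / s) * (B *ᵥ p) i₀)) :=
      tendsto_const_nhds.add ((hinv.mul hκ).mul_const _)
    simp only [zero_mul, add_zero] at h1
    refine h1.congr' ?_
    filter_upwards [eventually_gt_atTop 0] with t ht
    have := (hts t).ne'
    simp only [h, κ, Pi.add_apply, Pi.smul_apply, smul_eq_mul]
    field_simp
  have hdot (v : Fin m → ℝ) : Continuous fun w : Fin m → ℝ => v ⬝ᵥ w :=
    Continuous.dotProduct continuous_const continuous_id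
  have hqw : Tendsto (fun t => t⁻¹ * (q t ⬝ᵥ w t)) atTop (𝓝 (p ⬝ᵥ u)) := by
    have h1 := (hinv.mul (((hdot (B⁻¹ *ᵥ g)).tendsto _).comp hwlim)).add
      (((hdot p).tendsto _).comp hwlim)
    have e : p ⬝ᵥ (u + a • (x - (1 / s * (p ⬝ᵥ x)) • (B *ᵥ p))) = p ⬝ᵥ u := by
      simp only [dotProduct_add, dotProduct_sub, dotProduct_smul, smul_eq_mul, ← hs]
      field_simp
      ring
    rw [zero_mul, zero_add, e] at h1
    refine h1.congr' ?_
    filter_upwards [eventually_gt_atTop 0] with t ht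
    simp only [q, Function.comp, add_dotProduct, smul_dotProduct, smul_eq_mul]
    field_simp
  have hden : Tendsto (fun t => 1 + r + κ t * s) atTop (𝓝 (1 + r + 1)) := by
    have := (hκ.mul_const s).const_add (1 + r)
    rwa [one_div, inv_mul_cancel₀ hs0.ne'] at this
  have hslope : Tendsto (fun t => (t⁻¹ * (q t ⬝ᵥ w t)) / (1 + r + κ t * s) * h t i₀) atTop
      (𝓝 ((p ⬝ᵥ u) / (1 + r + 1) * g i₀)) :=
    (hqw.div hden (by positivity)).mul hhlim
  have hslope0 : (p ⬝ᵥ u) / (1 + r + 1) * g i₀ ≠ 0 :=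
    mul_ne_zero (div_ne_zero hpu (by positivity)) hg
  have hbig : Tendsto (fun t => |(q t ⬝ᵥ w t) / (1 + r + κ t * s) * h t i₀|) atTop atTop := by
    refine (tendsto_id.atTop_mul_pos (abs_pos.mpr hslope0) hslope.abs).congr' ?_
    filter_upwards [eventually_gt_atTop 0] with t ht
    rw [id, ← abs_of_pos ht, ← abs_mul, abs_of_pos ht]
    congr 1
    field_simp
  refine ⟨fun t => t • p, q, x i₀ - (p ⬝ᵥ x) / s * (B *ᵥ p) i₀, hne, ?_, ?_⟩
  · simp only [hy]
    have := (continuous_apply i₀).continuousAt.tendsto.comp hylim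
    simp only [Pi.sub_apply, Pi.smul_apply, smul_eq_mul, one_div_mul_eq_div] at this
    exact this
  · simp only [hy]
    have h1 := ((continuous_apply i₀).continuousAt.tendsto.comp hwlim).abs_add_const_mul_atTop
      hbig (neg_ne_zero.mpr one_ne_zero)
    refine h1.congr fun t => ?_
    have := congrFun (hz t) i₀
    simp only [w] at this
    rw [this]
    simp only [Function.comp, w, Pi.sub_apply, Pi.smul_apply, smul_eq_mul]
    congr 1
    ring

/-- **Lemma (producing a large component while staying off the hyperplanes).**
Let `m ≥ 2`, let `A` be row-stochastic with `a_{l0, j*} > 0`, let `d`, the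
hyperplanes `P_0, P_1, P_d`, and the coefficients `b_{l,k}` be as in the paper, let
`B` be positive definite, and let `C ∉ P_1`.  With `B_1 = (B⁻¹+v_1v_1ᵀ)⁻¹`,
`B_2 = (B⁻¹+v_1v_1ᵀ+v_2v_2ᵀ)⁻¹`, `Q_1(v_1)` and `Q_2(v_1,v_2)` the block-diagonal
matrices with blocks `B_1B⁻¹` resp. `B_2B_1⁻¹` in position `j*` and identity
elsewhere, and `Q_3(v_1,v_2) = (A⊗I_m)Q_2(v_1,v_2)(A⊗I_m)Q_1(v_1)C`, then for every
`L > 0` there exist `v_1, v_2 ∈ ℝ^m` with `(A⊗I_m)Q_1(v_1)C ∉ P_0`,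
`Q_3(v_1,v_2) ∉ P_d` and `|Q_3(v_1,v_2)[m(l0−1)+1]| > L`. -/
theorem diffusion_RLS_large_component_lemma
    {n m : ℕ} (hn : 1 ≤ n) (hm2 : 2 ≤ m) (hm : 0 < m)
    (A : Matrix (Fin n) (Fin n) ℝ)
    (hA_nonneg : ∀ i j, 0 ≤ A i j)
    (hA_row : ∀ i, ∑ j, A i j = 1)
    (js l0 : Fin n) (hl0 : 0 < A l0 js)
    (d : ℕ) (hd : 0 < (A ^ (d + 1)) js js)
    (hd_min : ∀ e, e < d → ¬ 0 < (A ^ (e + 1)) js js)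
    (b : ℕ → Fin n → ℝ)
    (hb1 : ∀ k, b 1 k = if k = js then 0 else A js k)
    (hbsucc : ∀ l k, 1 ≤ l → b (l + 1) k = ∑ i, b l i * A i k)
    (Pset : ℕ → Set (Fin n → Fin m → ℝ))
    (hP0 : Pset 0 = {C | C js ⟨0, hm⟩ = 0})
    (hPl : ∀ l, 1 ≤ l → Pset l = {C | ∑ k, b l k * C k ⟨0, hm⟩ = 0})
    (B : Matrix (Fin m) (Fin m) ℝ) (hB : B.PosDef)
    (C : Fin n → Fin m → ℝ) (hC : C ∉ Pset 1) :
    ∀ L : ℝ, 0 < L →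
      ∃ v1 v2 : Fin m → ℝ,
        ∀ D Q3 : Fin n → Fin m → ℝ,
          (D = fun i a => ∑ j, A i j *
            ((if j = js then
                (((B⁻¹ + Matrix.vecMulVec v1 v1)⁻¹ * B⁻¹).mulVec (C j))
              else C j) a)) →
          (Q3 = fun i a => ∑ j, A i j *
            ((if j = js then
                (((B⁻¹ + Matrix.vecMulVec v1 v1 + Matrix.vecMulVec v2 v2)⁻¹ *
                    (B⁻¹ + Matrix.vecMulVec v1 v1)).mulVec (D j))
              else D j) a)) →
          D ∉ Pset 0 ∧ Q3 ∉ Pset d ∧ L < |Q3 l0 ⟨0, hm⟩| := by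
  intro L _
  set i₀ : Fin m := ⟨0, hm⟩
  have hi : i₀ ≠ ⟨1, hm2⟩ := by simp [i₀]
  let u : Fin m → ℝ := ∑ k, b 1 k • C k
  have hu : u i₀ ≠ 0 := by
    rw [hPl 1 le_rfl] at hC
    simpa [u, Finset.sum_apply] using hC
  obtain ⟨v₁, v₂, y₀, hne, hy, hz⟩ :=
    exists_rank_one_updates_tendsto_atTop hB (C js) u (A js js) hi hu
  set y : ℝ → Fin m → ℝ := fun t => ((B⁻¹ + vecMulVec (v₁ t) (v₁ t))⁻¹ * B⁻¹) *ᵥ C js with hydef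
  set z : ℝ → Fin m → ℝ := fun t =>
    ((B⁻¹ + vecMulVec (v₁ t) (v₁ t) + vecMulVec (v₂ t) (v₂ t))⁻¹ *
      (B⁻¹ + vecMulVec (v₁ t) (v₁ t))) *ᵥ (u + A js js • y t) with hzdef
  let D : ℝ → Fin n → Fin m → ℝ := fun t i c => ∑ j, A i j * (if j = js then y t else C j) c
  have hDjs (t : ℝ) : D t js = u + A js js • y t := by
    ext c
    simp only [D, u, hb1, Pi.add_apply, Finset.sum_apply, Pi.smul_apply, smul_eq_mul]
    rw [← Finset.add_sum_erase _ _ (Finset.mem_univ js),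
      ← Finset.add_sum_erase (f := fun k => (if k = js then 0 else A js k) * C k c) _
        (Finset.mem_univ js)]
    simp only [if_true, zero_mul, zero_add]
    rw [add_comm]
    congr 1
    refine Finset.sum_congr rfl fun k hk => ?_
    simp [Finset.ne_of_mem_erase hk]
  have hDlim (j : Fin n) : ∃ c, Tendsto (fun t => D t j i₀) atTop (𝓝 c) := by
    refine ⟨∑ k, A j k * (if k = js then y₀ else C k i₀), tendsto_finsetSum _ fun k _ => ?_⟩
    refine Tendsto.const_mul _ ?_
    split_ifs
    · exact hy
    · exact tendsto_const_nhds
  choose δ hδ using hDlim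
  have hcomb (r : Fin n → ℝ) (hr : r js ≠ 0) :
      Tendsto (fun t => |∑ j, r j * (if j = js then z t else D t j) i₀|) atTop atTop := by
    have h1 : Tendsto (fun t => ∑ j ∈ Finset.univ.erase js, r j * D t j i₀) atTop
        (𝓝 (∑ j ∈ Finset.univ.erase js, r j * δ j)) :=
      tendsto_finsetSum _ fun j _ => (hδ j).const_mul _
    refine (h1.abs_add_const_mul_atTop hz hr).congr fun t => ?_
    rw [← Finset.sum_erase_add _ _ (Finset.mem_univ js), if_pos rfl]
    congr 2
    refine Finset.sum_congr rfl fun j hj => ?_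
    rw [if_neg (Finset.ne_of_mem_erase hj)]
  have hPd : ∀ᶠ t in atTop,
      (fun i c => ∑ j, A i j * (if j = js then z t else D t j) c) ∉ Pset d := by
    rcases Nat.eq_zero_or_pos d with rfl | hd0
    · rw [hP0]
      have hA : A js js ≠ 0 := by simpa using hd.ne'
      filter_upwards [(hcomb (A js) hA).eventually_gt_atTop 0] with t ht
      simpa using ht
    · have hA0 : A js js = 0 := by
        have := hd_min 0 hd0
        rw [zero_add, pow_one] at this
        exact le_antisymm (not_lt.mp this) (hA_nonneg _ _)
      have hb (l : ℕ) (k : Fin n) : b (l + 1) k = (A ^ (l + 1)) js k := by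
        induction l generalizing k with
        | zero =>
          rw [zero_add, hb1, pow_one]
          split_ifs with hk
          · rw [hk, hA0]
          · rfl
        | succ l ih =>
          rw [hbsucc _ _ (Nat.le_add_left 1 l), pow_succ A (l + 1), mul_apply]
          simp only [ih]
      rw [hPl d hd0]
      filter_upwards [(hcomb (b (d + 1)) (by rw [hb]; exact hd.ne')).eventually_gt_atTop 0]
        with t ht hmem
      refine ht.ne' (abs_eq_zero.mpr (Eq.trans ?_ hmem))
      simp only [hbsucc d _ hd0, Finset.sum_mul, Finset.mul_sum, mul_assoc]
      exact Finset.sum_comm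
  have hD0 : ∀ᶠ t in atTop, u i₀ + A js js * y t i₀ ≠ 0 :=
    ((hy.const_mul _).const_add _).eventually_ne hne
  obtain ⟨t, h1, h2, h3⟩ :=
    (hD0.and (hPd.and ((hcomb (A l0) hl0.ne').eventually_gt_atTop L))).exists
  refine ⟨v₁ t, v₂ t, ?_⟩
  intro D' Q3 hD' hQ3
  have hDeq : D' = D t := by
    subst hD'
    ext i c
    refine Finset.sum_congr rfl fun j _ => ?_
    by_cases hj : j = js
    · subst hj; simp [hydef]
    · simp [hj]
  have hQeq : Q3 = fun i c => ∑ j, A i j * (if j = js then z t else D t j) c := by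
    subst hQ3
    ext i c
    refine Finset.sum_congr rfl fun j _ => ?_
    by_cases hj : j = js
    · subst hj; simp [hzdef, hDeq, hDjs]
    · simp [hj, hDeq]
  refine ⟨?_, by rw [hQeq]; exact h2, by rw [hQeq]; exact h3⟩
  rw [hP0, hDeq]
  simpa [hDjs] using h1
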